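/- arXiv:1905.07351 — 2 statements merged into one kernel-verified Lean document; each statement's English description precedes it below -/
import Mathlib

section
/- Let α ∈ (0,2). There exists a constant c(α) > 0 with the following property: for every N ∈ ℕ, every a = (a₁,…,a_N) ∈ (ℝ\{0})^N, and every initial configuration x⁰ = (x₁⁰,…,x_N⁰) consisting of pairwise distinct points of ℝ², setting d₀ = min_{1≤i<j≤N} |x_i⁰ − x_j⁰| and T = c(α) d₀^{2+α} / (Σ_{i=1}^N |a_i|), there exists a solution x of the α-point-vortex model on [0,T] with intensities a and initial configuration x⁰; moreover this solution satisfies |x_i(t) − x_j(t)| ≥ d₀/2 for all 1 ≤ i < j ≤ N and all t ∈ [0,T]. -/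
open MeasureTheory Finset
noncomputable section

abbrev E2 : Type := EuclideanSpace ℝ (Fin 2)

def perp (z : E2) : E2 := !₂[-(z 1), z 0]

def Cconst (α : ℝ) : ℝ :=
  Real.Gamma (α / 2) / (2 ^ ((2:ℝ) - α) * Real.pi * Real.Gamma ((2 - α) / 2))

def K (α : ℝ) (z : E2) : E2 := (-(α * Cconst α) / ‖z‖ ^ (α + 2)) • perp z

def IsPVSol (α : ℝ) {N : ℕ} (a : Fin N → ℝ) (x0 : Fin N → E2) (T : ℝ)
    (x : ℝ → Fin N → E2) : Prop :=
  ContinuousOn x (Set.Icc 0 T) ∧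
  (∀ t ∈ Set.Icc 0 T, ∀ i j : Fin N, i ≠ j → x t i ≠ x t j) ∧
  (∀ i : Fin N, ∀ t ∈ Set.Icc 0 T,
    x t i = x0 i + ∑ j ∈ Finset.univ.erase i, a j • (∫ s in (0:ℝ)..t, K α (x s i - x s j)))

lemma perp_norm (z : E2) : ‖perp z‖ = ‖z‖ := by
  simp [perp, EuclideanSpace.norm_eq, Fin.sum_univ_two, add_comm]

lemma perp_contDiff : ContDiff ℝ 1 perp := by
  rw [contDiff_euclidean]
  intro i
  fin_cases i
  · simp only [perp]
    simp
    fun_prop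
  · simp only [perp]
    simp
    fun_prop

lemma K_contDiffAt (α : ℝ) (z : E2) (hz : z ≠ 0) : ContDiffAt ℝ 1 (K α) z := by
  unfold K
  have hn : ‖z‖ ≠ 0 := norm_ne_zero_iff.mpr hz
  refine ContDiffAt.smul (ContDiffAt.div contDiffAt_const ?_ ?_) perp_contDiff.contDiffAt
  · exact (contDiffAt_norm ℝ hz).rpow_const_of_ne hn
  · exact (Real.rpow_pos_of_pos (norm_pos_iff.mpr hz) _).ne'

lemma K_norm_le (α : ℝ) (hα : 0 < α) (z : E2) (r : ℝ) (hr : 0 < r) (hz : r ≤ ‖z‖) :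
    ‖K α z‖ ≤ (|α * Cconst α| + 1) * (r ^ (α + 1))⁻¹ := by
  have hn : 0 < ‖z‖ := hr.trans_le hz
  have h1 : ‖K α z‖ = |α * Cconst α| * (‖z‖ ^ (α + 1))⁻¹ := by
    have h2 : ‖z‖ ^ (α + 2) = ‖z‖ ^ (α + 1) * ‖z‖ := by
      rw [show α + 2 = (α + 1) + 1 by ring, Real.rpow_add_one hn.ne']
    have h3 : 0 < ‖z‖ ^ (α + 1) := Real.rpow_pos_of_pos hn _
    rw [K, norm_smul, perp_norm, norm_div, h2, norm_neg, Real.norm_eq_abs, Real.norm_eq_abs,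
      abs_of_pos (mul_pos h3 hn)]
    field_simp
  rw [h1]
  have h4 : 0 < r ^ (α + 1) := Real.rpow_pos_of_pos hr _
  have h5 : r ^ (α + 1) ≤ ‖z‖ ^ (α + 1) := Real.rpow_le_rpow hr.le hz (by linarith)
  gcongr
  linarith

def pvField (α : ℝ) {N : ℕ} (a : Fin N → ℝ) (x : Fin N → E2) : Fin N → E2 :=
  fun i => ∑ j ∈ Finset.univ.erase i, a j • K α (x i - x j)

lemma pvField_contDiffAt (α : ℝ) {N : ℕ} (a : Fin N → ℝ) (x : Fin N → E2)
    (hx : ∀ i j, i ≠ j → x i ≠ x j) : ContDiffAt ℝ 1 (pvField α a) x := by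
  rw [contDiffAt_pi]
  intro i
  unfold pvField
  refine ContDiffAt.sum fun j hj => ContDiffAt.const_smul (f := fun x : Fin N → E2 => K α (x i - x j)) (a j) ?_
  have hij : i ≠ j := (Finset.ne_of_mem_erase hj).symm
  have := K_contDiffAt α (x i - x j) (sub_ne_zero.mpr (hx i j hij))
  exact ContDiffAt.comp x (f := fun y : Fin N → E2 => y i - y j) this (by fun_prop)

lemma lip_of_contDiffAt {F : Type*} [NormedAddCommGroup F] [NormedSpace ℝ F] 
    (f : F → F) (s : Set F) (hs : IsCompact s) (hc : Convex ℝ s)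
    (hf : ∀ x ∈ s, ContDiffAt ℝ 1 f x) : ∃ k : NNReal, LipschitzOnWith k f s := by
  have h1 : ContinuousOn (fun x => fderiv ℝ f x) s := fun x hx =>
    ((hf x hx).fderiv_right (m := 0) (by norm_num)).continuousAt.continuousWithinAt
  obtain ⟨k, hk⟩ := hs.exists_bound_of_continuousOn h1
  refine ⟨k.toNNReal, hc.lipschitzOnWith_of_nnnorm_fderiv_le
    (fun x hx => (hf x hx).differentiableAt (by norm_num)) (fun x hx => ?_)⟩
  exact NNReal.le_toNNReal_of_coe_le (hk x hx)

/-- local existence for the α-point-vortex model, with explicit lower bound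
on the existence time, and separation ≥ d₀/2 on the existence interval.  Here d₀ is any
positive lower bound for the minimal initial mutual distance (in particular the minimum
itself). -/
theorem pv_local_existence
    (α : ℝ) (hα : α ∈ Set.Ioo (0:ℝ) 2) :
    ∃ c > (0:ℝ), ∀ (N : ℕ) (a : Fin N → ℝ), (∀ i, a i ≠ 0) →
      ∀ x0 : Fin N → E2, (∀ i j : Fin N, i ≠ j → x0 i ≠ x0 j) →
      ∀ d0 > (0:ℝ), (∀ i j : Fin N, i ≠ j → d0 ≤ dist (x0 i) (x0 j)) →
      ∃ x : ℝ → Fin N → E2,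
        IsPVSol α a x0 (c * d0 ^ ((2:ℝ) + α) / ∑ i : Fin N, |a i|) x ∧
        ∀ t ∈ Set.Icc (0:ℝ) (c * d0 ^ ((2:ℝ) + α) / ∑ i : Fin N, |a i|),
          ∀ i j : Fin N, i ≠ j → d0 / 2 ≤ dist (x t i) (x t j) := by
  have hα0 := hα.1
  set M : ℝ := |α * Cconst α| + 1 with hM
  have hMp : 0 < M := by positivity
  have h2p : 0 < (2:ℝ) ^ (α + 1) := by positivity
  refine ⟨1 / (4 * M * 2 ^ (α + 1)), by positivity, ?_⟩
  intro N a _ x0 _ d0 hd0 hsep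
  set A : ℝ := ∑ i : Fin N, |a i| with hA
  have hA0 : 0 ≤ A := Finset.sum_nonneg fun i _ => abs_nonneg _
  set T : ℝ := 1 / (4 * M * 2 ^ (α + 1)) * d0 ^ ((2:ℝ) + α) / A with hT
  have hT0 : 0 ≤ T := by positivity
  have hball : ∀ x ∈ Metric.closedBall x0 (d0 / 4), ∀ i j, i ≠ j → d0 / 2 ≤ dist (x i) (x j) := by
    intro x hx i j hij
    rw [Metric.mem_closedBall] at hx
    have h1 := (dist_le_pi_dist x x0 i).trans hx
    have h2 := (dist_le_pi_dist x x0 j).trans hx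
    have h3 := hsep i j hij
    have h4 := dist_triangle4 (x0 i) (x i) (x j) (x0 j)
    rw [dist_comm (x0 i) (x i)] at h4
    linarith
  have hne : ∀ x ∈ Metric.closedBall x0 (d0 / 4), ∀ i j, i ≠ j → x i ≠ x j := by
    intro x hx i j hij
    exact dist_pos.mp (lt_of_lt_of_le (by positivity) (hball x hx i j hij))
  obtain ⟨k, hk⟩ := lip_of_contDiffAt (pvField α a) (Metric.closedBall x0 (d0 / 4))
    (isCompact_closedBall _ _) (convex_closedBall _ _)
    (fun x hx => pvField_contDiffAt α a x (hne x hx))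
  set L : ℝ := A * (M * ((d0 / 2) ^ (α + 1))⁻¹) with hL
  have hdp : 0 < (d0 / 2) ^ (α + 1) := by positivity
  have hL0 : 0 ≤ L := by positivity
  have hbd : ∀ x ∈ Metric.closedBall x0 (d0 / 4), ‖pvField α a x‖ ≤ L := by
    intro x hx
    rw [pi_norm_le_iff_of_nonneg hL0]
    intro i
    unfold pvField
    calc _ ≤ ∑ j ∈ Finset.univ.erase i, ‖a j • K α (x i - x j)‖ := norm_sum_le _ _
      _ ≤ ∑ j ∈ Finset.univ.erase i, |a j| * (M * ((d0 / 2) ^ (α + 1))⁻¹) := by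
        refine Finset.sum_le_sum fun j hj => ?_
        rw [norm_smul, Real.norm_eq_abs]
        have hij : i ≠ j := (Finset.ne_of_mem_erase hj).symm
        have h := hball x hx i j hij
        rw [dist_eq_norm] at h
        exact mul_le_mul_of_nonneg_left (K_norm_le α hα0 _ _ (by positivity) h) (abs_nonneg _)
      _ ≤ ∑ j : Fin N, |a j| * (M * ((d0 / 2) ^ (α + 1))⁻¹) :=
        Finset.sum_le_sum_of_subset_of_nonneg (Finset.erase_subset _ _)
          (fun _ _ _ => by positivity)
      _ = L := by rw [← Finset.sum_mul]
  have hLT : L * T ≤ d0 / 4 := by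
    rcases hA0.eq_or_lt with h | h
    · rw [hL, ← h]; simp; positivity
    · have e1 : d0 ^ ((2:ℝ) + α) = d0 ^ (α + 1) * d0 := by
        rw [show (2:ℝ) + α = (α + 1) + 1 by ring, Real.rpow_add_one hd0.ne']
      have e2 : (d0 / 2) ^ (α + 1) = d0 ^ (α + 1) / 2 ^ (α + 1) :=
        Real.div_rpow hd0.le (by norm_num) _
      have e3 : 0 < d0 ^ (α + 1) := by positivity
      rw [hL, hT, e1, e2]
      apply le_of_eq
      generalize d0 ^ (α + 1) = p at *
      generalize (2:ℝ) ^ (α + 1) = q at *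
      field_simp
  have hm : ((⟨L, hL0⟩ : NNReal) : ℝ) * max (T - (⟨0, Set.left_mem_Icc.mpr hT0⟩ : Set.Icc (0:ℝ) T))
      ((⟨0, Set.left_mem_Icc.mpr hT0⟩ : Set.Icc (0:ℝ) T) - 0) ≤
      ((⟨d0 / 4, by positivity⟩ : NNReal) : ℝ) - ((0 : NNReal) : ℝ) := by
    simpa [hT0] using hLT
  have hPL : IsPicardLindelof (fun _ => pvField α a) (⟨0, Set.left_mem_Icc.mpr hT0⟩ : Set.Icc (0:ℝ) T) x0
      ⟨d0 / 4, by positivity⟩ 0 ⟨L, hL0⟩ k :=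
    IsPicardLindelof.of_time_independent hbd hk hm
  obtain ⟨w, hcont, hmem, hw⟩ : ∃ w : ℝ → Fin N → E2, Continuous w ∧
      (∀ t, w t ∈ Metric.closedBall x0 (d0 / 4)) ∧
      ∀ t ∈ Set.Icc 0 T, w t = x0 + ∫ s in (0:ℝ)..t, pvField α a (w s) := by
    obtain ⟨y, hy⟩ := ODE.FunSpace.exists_isFixedPt_next hPL
      (x := x0) (Metric.mem_closedBall_self (by simp))
    replace hy := (ODE.FunSpace.isFixedPt_next_iff _ _).mp hy
    exact ⟨y.compProj, y.continuous_compProj, fun t => y.compProj_mem_closedBall hm,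
      fun t ht => (ODE.FunSpace.compProj_of_mem ht).trans (hy ⟨t, ht⟩)⟩
  refine ⟨w, ⟨hcont.continuousOn, fun t _ => hne _ (hmem t), ?_⟩,
    fun t _ => hball _ (hmem t)⟩
  intro i t ht
  rw [hw t ht]
  have hfc : Continuous fun s => pvField α a (w s) :=
    continuous_iff_continuousAt.mpr fun s =>
      ((pvField_contDiffAt α a _ (hne _ (hmem s))).continuousAt).comp
        (f := w) hcont.continuousAt
  have h2 := (ContinuousLinearMap.proj (R := ℝ) (φ := fun _ : Fin N => E2) i).intervalIntegral_comp_comm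
    (hfc.intervalIntegrable (μ := volume) 0 t)
  simp only [ContinuousLinearMap.proj_apply] at h2
  rw [Pi.add_apply, ← h2]
  congr 1
  unfold pvField
  have hKc : ∀ j ∈ Finset.univ.erase i,
      Continuous fun s => K α (w s i - w s j) := by
    intro j hj
    have hij : i ≠ j := (Finset.ne_of_mem_erase hj).symm
    refine continuous_iff_continuousAt.mpr fun s => ?_
    refine ContinuousAt.comp (f := fun s => w s i - w s j)
      (K_contDiffAt α _ (sub_ne_zero.mpr (hne _ (hmem s) i j hij))).continuousAt ?_
    exact (((continuous_apply i).comp hcont).sub ((continuous_apply j).comp hcont)).continuousAt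
  rw [intervalIntegral.integral_finsetSum
    (f := fun j s => a j • K α (w s i - w s j)) (fun j hj => ((hKc j hj).const_smul (a j)).intervalIntegrable _ _)]
  refine Finset.sum_congr rfl fun j _ => ?_
  rw [intervalIntegral.integral_smul]
end
end

section
/- Let α ∈ (0,2), N ∈ ℕ, T > 0, let a₁,…,a_N > 0 all be positive, and let x⁰ = (x₁⁰,…,x_N⁰) consist of pairwise distinct points of ℝ². If x is a solution of the α-point-vortex model on [0,T] with intensities a and initial configuration x⁰, then for all t ∈ [0,T] and all 1 ≤ i < j ≤ N, |x_i(t) − x_j(t)| ≥ (C_α a_i a_j / H_α(x⁰))^{1/α} ≥ (C_α min_{1≤k≠l≤N} a_k a_l / H_α(x⁰))^{1/α}, where H_α(x⁰) = (1/2) Σ_{1≤k≠l≤N} a_k a_l C_α |x_k⁰ − x_l⁰|^{−α} > 0. -/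
open MeasureTheory Finset
noncomputable section

theorem aux_Cpos {α : ℝ} (hα : α ∈ Set.Ioo (0:ℝ) 2) : 0 < Cconst α := by
  unfold Cconst
  have h1 : 0 < Real.Gamma (α / 2) := Real.Gamma_pos_of_pos (by linarith [hα.1])
  have h2 : 0 < Real.Gamma ((2 - α) / 2) := Real.Gamma_pos_of_pos (by linarith [hα.2])
  have := Real.pi_pos
  positivity

theorem aux_inner (z w : E2) : inner ℝ z (perp w) = z 1 * w 0 - z 0 * w 1 := by
  simp [perp, PiLp.inner_apply, Fin.sum_univ_two]; ring

theorem aux_perp_cont : Continuous perp := by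
  unfold perp
  fun_prop

theorem aux_K_zero (α : ℝ) : K α 0 = 0 := by
  have : perp 0 = 0 := by
    ext i; fin_cases i <;> simp [perp]
  simp [K, this]

theorem aux_K_cont (α : ℝ) {f : ℝ → E2} (hf : Continuous f) (h0 : ∀ s, f s ≠ 0) :
    Continuous fun s => K α (f s) := by
  unfold K
  have hp : Continuous fun s => perp (f s) := aux_perp_cont.comp hf
  suffices h : Continuous fun s => -(α * Cconst α) / ‖f s‖ ^ (α + 2) from h.smul hp
  refine continuous_const.div (hf.norm.rpow_const fun s => Or.inl (norm_ne_zero_iff.2 (h0 s))) ?_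
  intro s
  exact (Real.rpow_pos_of_pos (norm_pos_iff.2 (h0 s)) _).ne'

theorem aux_norm_deriv (α : ℝ) {f : ℝ → E2} {f' : E2} {t : ℝ} (hf : HasDerivAt f f' t)
    (h0 : f t ≠ 0) :
    HasDerivAt (fun s => ‖f s‖ ^ (-α)) (-α / ‖f t‖ ^ (α + 2) * inner ℝ (f t) f') t := by
  have hp := norm_pos_iff.2 h0
  have h1 := (hf.norm_sq).rpow_const (p := -α / 2) (Or.inl (by positivity))
  have e : (fun s => ‖f s‖ ^ (-α)) = fun s => (‖f s‖ ^ 2) ^ (-α / 2) := by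
    funext s
    rw [← Real.rpow_natCast, ← Real.rpow_mul (norm_nonneg _)]
    congr 1; push_cast; ring
  rw [e]
  convert h1 using 1
  have : (‖f t‖ ^ 2) ^ (-α / 2 - 1) = (‖f t‖ ^ (α + 2))⁻¹ := by
    rw [← Real.rpow_natCast, ← Real.rpow_mul (norm_nonneg _), ← Real.rpow_neg (norm_nonneg _)]
    congr 1; push_cast; ring
  rw [this]
  field_simp

/-- algebraic cancellation -/
theorem aux_alg (α : ℝ) {N : ℕ} (a : Fin N → ℝ) (x : Fin N → E2) :
    ∑ i, ∑ j, a i * a j * Cconst α * (-α / ‖x i - x j‖ ^ (α + 2) *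
      inner ℝ (x i - x j) ((∑ k, a k • K α (x i - x k)) - ∑ k, a k • K α (x j - x k))) = 0 := by
  set v : Fin N → E2 := fun i => ∑ k, a k • K α (x i - x k) with hv
  set g : Fin N → Fin N → ℝ := fun i j => -(α * Cconst α) / ‖x i - x j‖ ^ (α + 2) with hg
  have gs : ∀ i j, g i j = g j i := fun i j => by simp only [hg, norm_sub_rev]
  have key : ∀ i, ∑ j, a j * g i j * inner ℝ (x i - x j) (v i) = 0 := by
    intro i
    have e : ∑ j, a j * g i j * inner ℝ (x i - x j) (v i) =
        ∑ j, ∑ k, a j * g i j * (a k * g i k) * inner ℝ (x i - x j) (perp (x i - x k)) := by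
      refine Finset.sum_congr rfl fun j _ => ?_
      simp only [hv, inner_sum, Finset.mul_sum, K, inner_smul_right]
      refine Finset.sum_congr rfl fun k _ => ?_
      simp only [hg]; ring
    have e2 : ∑ j, ∑ k, a j * g i j * (a k * g i k) * inner ℝ (x i - x j) (perp (x i - x k)) =
        - ∑ j, ∑ k, a j * g i j * (a k * g i k) * inner ℝ (x i - x j) (perp (x i - x k)) := by
      conv_lhs => rw [Finset.sum_comm]
      simp only [← Finset.sum_neg_distrib]
      refine Finset.sum_congr rfl fun j _ => Finset.sum_congr rfl fun k _ => ?_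
      rw [aux_inner, aux_inner]; ring
    rw [e]; linarith
  have s1 : ∑ i, ∑ j, a i * (a j * g i j * inner ℝ (x i - x j) (v i)) = 0 := by
    simp only [← Finset.mul_sum, key, mul_zero, Finset.sum_const_zero]
  have s2 : ∑ i, ∑ j, a j * (a i * g j i * inner ℝ (x j - x i) (v j)) = 0 := by
    rw [Finset.sum_comm]; exact s1
  have : ∑ i, ∑ j, a i * a j * Cconst α * (-α / ‖x i - x j‖ ^ (α + 2) *
      inner ℝ (x i - x j) (v i - v j)) =
      ∑ i, ∑ j, a i * (a j * g i j * inner ℝ (x i - x j) (v i)) +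
      ∑ i, ∑ j, a j * (a i * g j i * inner ℝ (x j - x i) (v j)) := by
    simp only [← Finset.sum_add_distrib]
    refine Finset.sum_congr rfl fun i _ => Finset.sum_congr rfl fun j _ => ?_
    rw [gs j i, ← neg_sub (x i) (x j), inner_neg_left, inner_sub_right]
    simp only [hg]; ring
  rw [this, s1, s2, add_zero]

theorem aux_const (α : ℝ) (hα : α ∈ Set.Ioo (0:ℝ) 2) (N : ℕ) (a : Fin N → ℝ)
    (T : ℝ) (hT : 0 < T) (x0 : Fin N → E2) (x : ℝ → Fin N → E2) (hx : IsPVSol α a x0 T x) :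
    ∀ t ∈ Set.Icc (0:ℝ) T, ∑ i, ∑ j, a i * a j * Cconst α * ‖x t i - x t j‖ ^ (-α) =
      ∑ i, ∑ j, a i * a j * Cconst α * ‖x0 i - x0 j‖ ^ (-α) := by
  obtain ⟨hc, hne, heq⟩ := hx
  set y : ℝ → Fin N → E2 := fun s => x (Set.projIcc 0 T hT.le s) with hy
  have yc : Continuous y := by
    have := (continuousOn_iff_continuous_domRestrict.1 hc).comp
      (continuous_projIcc (a := (0:ℝ)) (b := T) (h := hT.le))
    exact this
  have yx : ∀ s ∈ Set.Icc 0 T, y s = x s := fun s hs => by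
    simp only [hy, Set.projIcc_of_mem hT.le hs]
  have yne : ∀ s, ∀ i j, i ≠ j → y s i - y s j ≠ 0 := fun s i j hij =>
    sub_ne_zero.2 (hne _ (Set.projIcc 0 T hT.le s).2 i j hij)
  have Kc : ∀ i j, Continuous fun s => K α (y s i - y s j) := by
    intro i j
    by_cases hij : i = j
    · subst hij; simp only [sub_self]; exact continuous_const
    · exact aux_K_cont α (by fun_prop) (fun s => yne s i j hij)
  set z : ℝ → Fin N → E2 := fun t i =>
    x0 i + ∑ j, a j • ∫ s in (0:ℝ)..t, K α (y s i - y s j) with hz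
  have zx : ∀ t ∈ Set.Icc 0 T, z t = x t := by
    intro t ht
    funext i
    rw [heq i t ht]
    simp only [hz]
    rw [Finset.sum_erase _ (by simp [aux_K_zero])]
    congr 1
    refine Finset.sum_congr rfl fun j _ => ?_
    congr 1
    refine intervalIntegral.integral_congr fun s hs => ?_
    rw [Set.uIcc_of_le ht.1] at hs
    simp only [yx s ⟨hs.1, hs.2.trans ht.2⟩]
  have zd : ∀ t i, HasDerivAt (fun s => z s i) (∑ j, a j • K α (y t i - y t j)) t := by
    intro t i
    simp only [hz]
    refine HasDerivAt.const_add _ (HasDerivAt.fun_sum fun j _ => HasDerivAt.fun_const_smul _ ?_)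
    exact intervalIntegral.integral_hasDerivAt_right ((Kc i j).intervalIntegrable _ _)
      ((Kc i j).stronglyMeasurableAtFilter _ _) (Kc i j).continuousAt
  have Hd : ∀ t ∈ Set.Icc 0 T, HasDerivAt
      (fun t => ∑ i, ∑ j, a i * a j * Cconst α * ‖z t i - z t j‖ ^ (-α)) 0 t := by
    intro t ht
    have e : z t = y t := by rw [zx t ht, yx t ht]
    rw [← aux_alg α a (z t)]
    refine HasDerivAt.fun_sum fun i _ => HasDerivAt.fun_sum fun j _ => HasDerivAt.const_mul _ ?_
    by_cases hij : i = j
    · subst hij; simp only [sub_self, inner_zero_left, mul_zero]; exact hasDerivAt_const _ _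
    · have h1 := (zd t i).fun_sub (zd t j)
      rw [← e] at h1
      exact aux_norm_deriv α h1 (by rw [e]; exact yne t i j hij)
  intro t ht
  have := constant_of_has_deriv_right_zero
    (fun s hs => (Hd s hs).continuousAt.continuousWithinAt)
    (fun s hs => (Hd s ⟨hs.1, hs.2.le⟩).hasDerivWithinAt) t ht
  simp only [zx t ht] at this
  rw [this]
  simp [hz]

/-- lower bound on mutual distances for identically signed intensities,
via conservation of the Hamiltonian.  Here H is the Hamiltonian of the initial
configuration, and the infimum runs over all pairs of distinct indices. -/
theorem pv_separation_lower_bound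
    (α : ℝ) (hα : α ∈ Set.Ioo (0:ℝ) 2)
    (N : ℕ) (hN : 2 ≤ N)
    (a : Fin N → ℝ) (ha : ∀ i, 0 < a i)
    (T : ℝ) (hT : 0 < T)
    (x0 : Fin N → E2) (hx0 : ∀ i j : Fin N, i ≠ j → x0 i ≠ x0 j)
    (x : ℝ → Fin N → E2) (hx : IsPVSol α a x0 T x) :
    (0 < (1/2 : ℝ) * ∑ i : Fin N, ∑ j ∈ Finset.univ.erase i,
        a i * a j * Cconst α * ‖x0 i - x0 j‖ ^ (-α)) ∧
    ∀ t ∈ Set.Icc (0:ℝ) T, ∀ i j : Fin N, i ≠ j →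
      (Cconst α * (⨅ p : {q : Fin N × Fin N // q.1 ≠ q.2}, a (p : Fin N × Fin N).1 * a (p : Fin N × Fin N).2) /
          ((1/2 : ℝ) * ∑ k : Fin N, ∑ l ∈ Finset.univ.erase k,
            a k * a l * Cconst α * ‖x0 k - x0 l‖ ^ (-α))) ^ ((1:ℝ)/α)
        ≤ (Cconst α * (a i * a j) /
          ((1/2 : ℝ) * ∑ k : Fin N, ∑ l ∈ Finset.univ.erase k,
            a k * a l * Cconst α * ‖x0 k - x0 l‖ ^ (-α))) ^ ((1:ℝ)/α) ∧
      (Cconst α * (a i * a j) /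
          ((1/2 : ℝ) * ∑ k : Fin N, ∑ l ∈ Finset.univ.erase k,
            a k * a l * Cconst α * ‖x0 k - x0 l‖ ^ (-α))) ^ ((1:ℝ)/α)
        ≤ dist (x t i) (x t j) := by
  have hC := aux_Cpos hα
  have hα0 := hα.1
  have hcons := aux_const α hα N a T hT x0 x hx
  have er : ∀ u : Fin N → E2, ∑ k : Fin N, ∑ l ∈ Finset.univ.erase k,
      a k * a l * Cconst α * ‖u k - u l‖ ^ (-α) =
      ∑ k, ∑ l, a k * a l * Cconst α * ‖u k - u l‖ ^ (-α) := by
    intro u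
    refine Finset.sum_congr rfl fun k _ => Finset.sum_erase _ ?_
    simp [Real.zero_rpow (neg_ne_zero.2 hα0.ne')]
  have low : ∀ u : Fin N → E2, ∀ i j : Fin N, i ≠ j →
      Cconst α * (a i * a j) * ‖u i - u j‖ ^ (-α) ≤
      (1/2 : ℝ) * ∑ k, ∑ l, a k * a l * Cconst α * ‖u k - u l‖ ^ (-α) := by
    intro u i j hij
    have nn : ∀ k l, 0 ≤ a k * a l * Cconst α * ‖u k - u l‖ ^ (-α) := fun k l => by
      have := ha k
      have := ha l
      positivity
    have h1 : ∀ k l, a k * a l * Cconst α * ‖u k - u l‖ ^ (-α) ≤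
        ∑ l, a k * a l * Cconst α * ‖u k - u l‖ ^ (-α) := fun k l =>
      Finset.single_le_sum (f := fun l => a k * a l * Cconst α * ‖u k - u l‖ ^ (-α))
        (fun l _ => nn k l) (Finset.mem_univ l)
    have h2 := Finset.add_le_sum
      (f := fun k => ∑ l, a k * a l * Cconst α * ‖u k - u l‖ ^ (-α))
      (fun k _ => Finset.sum_nonneg fun l _ => nn k l)
      (Finset.mem_univ i) (Finset.mem_univ j) hij
    have h3 := h1 i j
    have h4 := h1 j i
    rw [norm_sub_rev (u j) (u i)] at h4
    nlinarith
  simp only [er]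
  have Hpos : 0 < (1/2 : ℝ) * ∑ i, ∑ j, a i * a j * Cconst α * ‖x0 i - x0 j‖ ^ (-α) := by
    have hij : (⟨0, by omega⟩ : Fin N) ≠ ⟨1, by omega⟩ := by simp
    refine lt_of_lt_of_le ?_ (low x0 _ _ hij)
    have h1 := norm_pos_iff.2 (sub_ne_zero.2 (hx0 _ _ hij))
    exact mul_pos (mul_pos hC (mul_pos (ha _) (ha _))) (Real.rpow_pos_of_pos h1 _)
  refine ⟨Hpos, fun t ht i j hij => ⟨?_, ?_⟩⟩
  · have hle : (⨅ p : {q : Fin N × Fin N // q.1 ≠ q.2},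
        a (p : Fin N × Fin N).1 * a (p : Fin N × Fin N).2) ≤ a i * a j :=
      ciInf_le (f := fun p : {q : Fin N × Fin N // q.1 ≠ q.2} =>
        a (p : Fin N × Fin N).1 * a (p : Fin N × Fin N).2) (Set.finite_range _).bddBelow
        ⟨(i, j), hij⟩
    have hnn : 0 ≤ (⨅ p : {q : Fin N × Fin N // q.1 ≠ q.2},
        a (p : Fin N × Fin N).1 * a (p : Fin N × Fin N).2) :=
      Real.iInf_nonneg fun p => (mul_pos (ha _) (ha _)).le
    refine Real.rpow_le_rpow (div_nonneg (mul_nonneg hC.le hnn) Hpos.le) ?_ (by positivity)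
    exact div_le_div_of_nonneg_right (mul_le_mul_of_nonneg_left hle hC.le) Hpos.le
  · have h1 := low (x t) i j hij
    rw [hcons t ht] at h1
    have hd : 0 < ‖x t i - x t j‖ := norm_pos_iff.2 (sub_ne_zero.2 (hx.2.1 t ht i j hij))
    rw [dist_eq_norm]
    have h2 : Cconst α * (a i * a j) /
        ((1/2 : ℝ) * ∑ k, ∑ l, a k * a l * Cconst α * ‖x0 k - x0 l‖ ^ (-α)) ≤
        ‖x t i - x t j‖ ^ α := by
      rw [div_le_iff₀ Hpos]
      rw [Real.rpow_neg hd.le, ← div_eq_mul_inv, div_le_iff₀ (Real.rpow_pos_of_pos hd _)] at h1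
      linarith
    have h3 := Real.rpow_le_rpow
      (div_nonneg (mul_nonneg hC.le (mul_pos (ha i) (ha j)).le) Hpos.le) h2
      (by positivity : 0 ≤ 1 / α)
    rwa [← Real.rpow_mul hd.le, mul_one_div_cancel hα0.ne', Real.rpow_one] at h3
end
end
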